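/- Rank-stability of a finitely presented algebra does not depend on its presentation: let F be a field, let P_1,…,P_r ∈ F⟨x_1,…,x_d⟩ and Q_1,…,Q_s ∈ F⟨y_1,…,y_e⟩ be noncommutative polynomials, and suppose there is an F-algebra isomorphism F⟨x_1,…,x_d⟩/⟨P_1,…,P_r⟩ ≅ F⟨y_1,…,y_e⟩/⟨Q_1,…,Q_s⟩ (quotients by the two-sided ideals generated by the listed relations). If the presentation F⟨x_1,…,x_d⟩/⟨P_1,…,P_r⟩ is rank-stable, then the presentation F⟨y_1,…,y_e⟩/⟨Q_1,…,Q_s⟩ is rank-stable. -/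

import Mathlib

open Matrix

noncomputable section

/-- Zero-padding of a square matrix to size `m` (the ℕ×ℕ extension `Â`, clipped to size `m`). -/
def padTo {F : Type} [Zero F] {n : ℕ} (m : ℕ) (A : Matrix (Fin n) (Fin n) F) :
    Matrix (Fin m) (Fin m) F :=
  Matrix.of fun i j =>
    if h : (i : ℕ) < n ∧ (j : ℕ) < n then A ⟨i, h.1⟩ ⟨j, h.2⟩ else 0

/-- `Rank(Â − B̂)` for `A ∈ M_n(F)` and `B ∈ M_{n'}(F)`. -/
def padRankDiff {F : Type} [Field F] {n n' : ℕ} (A : Matrix (Fin n) (Fin n) F)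
    (B : Matrix (Fin n') (Fin n') F) : ℕ :=
  (padTo (max n n') A - padTo (max n n') B).rank

/-- Evaluation of a noncommutative polynomial `P ∈ F⟨x_s : s ∈ σ⟩` at a tuple of matrices,
where scalar terms are interpreted as scalar matrices. -/
def evalPoly {F : Type} [Field F] {σ : Type} {n : ℕ}
    (P : FreeAlgebra F σ) (A : σ → Matrix (Fin n) (Fin n) F) :
    Matrix (Fin n) (Fin n) F :=
  FreeAlgebra.lift F A P

/-- Rank-stability of the presentation `F⟨x_s : s ∈ σ⟩ / ⟨P_i : i ∈ ι⟩`. -/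
def RankStable (F : Type) [Field F] {σ ι : Type} (P : ι → FreeAlgebra F σ) : Prop :=
  ∀ ε : ℝ, 0 < ε → ∃ δ : ℝ, 0 < δ ∧
    ∀ n : ℕ, 0 < n → ∀ A : σ → Matrix (Fin n) (Fin n) F,
      (∀ i, ((evalPoly (P i) A).rank : ℝ) < δ * n) →
      ∃ n' : ℕ, 0 < n' ∧ ∃ B : σ → Matrix (Fin n') (Fin n') F,
        (∀ i, evalPoly (P i) B = 0) ∧
        ∀ j, ((padRankDiff (A j) (B j) : ℝ) < ε * n)

section RankInequalities

variable {F : Type} [Field F] {l m n : Type*} [Fintype m] [Fintype n]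

lemma Matrix.rank_add_le_add_rank [Finite l] (A B : Matrix l m F) :
    (A + B).rank ≤ A.rank + B.rank := by
  have := Fintype.ofFinite l
  have h : LinearMap.range (A + B).mulVecLin ≤
      LinearMap.range A.mulVecLin ⊔ LinearMap.range B.mulVecLin := by
    rw [Matrix.mulVecLin_add]
    rintro _ ⟨v, rfl⟩
    exact Submodule.add_mem_sup ⟨v, rfl⟩ ⟨v, rfl⟩
  exact (Submodule.finrank_mono h).trans (Submodule.finrank_add_le_finrank_add_finrank _ _)

lemma Matrix.rank_sum_le_sum_rank [Finite l] {ι : Type*} (s : Finset ι) (A : ι → Matrix l m F) :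
    (∑ i ∈ s, A i).rank ≤ ∑ i ∈ s, (A i).rank := by
  classical
  induction s using Finset.induction_on with
  | empty => simp
  | insert a s ha ih =>
    rw [Finset.sum_insert ha, Finset.sum_insert ha]
    exact (rank_add_le_add_rank _ _).trans (by gcongr)

lemma Matrix.rank_neg_eq [Finite l] (A : Matrix l m F) : (-A).rank = A.rank := by
  have h : (-A).mulVecLin = -A.mulVecLin := by
    ext v : 1
    simp
  rw [Matrix.rank, Matrix.rank, h, LinearMap.range_neg]

lemma Matrix.rank_mul_mul_le [Finite l] {k : Type*} [Fintype k] (A : Matrix l m F)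
    (B : Matrix m n F) (C : Matrix n k F) : (A * B * C).rank ≤ B.rank :=
  (rank_mul_le_left _ _).trans (rank_mul_le_right _ _)

lemma Matrix.eq_zero_of_rank_eq_zero {l m : Type*} [Finite l] [Fintype m] [DecidableEq m]
    {A : Matrix l m F} (h : A.rank = 0) : A = 0 := by
  have := Fintype.ofFinite l
  rw [Matrix.rank, Submodule.finrank_eq_zero, LinearMap.range_eq_bot] at h
  rwa [← Matrix.toLin'_apply', LinearEquiv.map_eq_zero_iff] at h

/-- Every matrix factors as `N = R * q` through its rank, with `q` right invertible and `R` left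
invertible. -/
lemma Matrix.exists_rank_factorization [DecidableEq m] [DecidableEq n] (N : Matrix m n F)
    {k : ℕ} (hk : N.rank = k) :
    ∃ (R : Matrix m (Fin k) F) (q : Matrix (Fin k) n F)
      (L : Matrix (Fin k) m F) (s : Matrix n (Fin k) F),
      R * q = N ∧ L * R = 1 ∧ q * s = 1 := by
  subst hk
  let e : LinearMap.range N.mulVecLin ≃ₗ[F] (Fin N.rank → F) :=
    (Module.finBasis F (LinearMap.range N.mulVecLin)).equivFun
  let f : (n → F) →ₗ[F] (Fin N.rank → F) := e.toLinearMap ∘ₗ N.mulVecLin.rangeRestrict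
  let g : (Fin N.rank → F) →ₗ[F] (m → F) :=
    (LinearMap.range N.mulVecLin).subtype ∘ₗ e.symm.toLinearMap
  have hgf : g ∘ₗ f = N.mulVecLin := LinearMap.ext fun v => by simp [f, g]
  have hf : LinearMap.range f = ⊤ := by
    rw [LinearMap.range_eq_top]
    exact e.surjective.comp N.mulVecLin.surjective_rangeRestrict
  have hg : LinearMap.ker g = ⊥ := by
    rw [LinearMap.ker_eq_bot]
    exact Subtype.val_injective.comp e.symm.injective
  obtain ⟨s, hs⟩ := f.exists_rightInverse_of_surjective hf
  obtain ⟨L, hL⟩ := g.exists_leftInverse_of_injective hg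
  refine ⟨LinearMap.toMatrix' g, LinearMap.toMatrix' f, LinearMap.toMatrix' L,
    LinearMap.toMatrix' s, ?_, ?_, ?_⟩
  · rw [← LinearMap.toMatrix'_comp, hgf, ← Matrix.toLin'_apply', LinearMap.toMatrix'_toLin']
  · rw [← LinearMap.toMatrix'_comp, hL, LinearMap.toMatrix'_id]
  · rw [← LinearMap.toMatrix'_comp, hs, LinearMap.toMatrix'_id]

end RankInequalities

section Truncation

variable {F : Type} [Field F]

/-- The `m × n` matrix with ones on the main diagonal: the inclusion of `Fⁿ` in `Fᵐ` when `n ≤ m`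
and the truncation of `Fⁿ` to its first `m` coordinates when `m ≤ n`. -/
def inclMat (F : Type) [Field F] (n m : ℕ) : Matrix (Fin m) (Fin n) F :=
  Matrix.of fun i j => if (i : ℕ) = j then 1 else 0

/-- The projection of `Fᵐ` onto its coordinates of index at least `n`. -/
def tailProj (F : Type) [Field F] (n m : ℕ) : Matrix (Fin m) (Fin m) F :=
  1 - inclMat F n m * inclMat F m n

lemma inclMat_self (n : ℕ) : inclMat F n n = 1 := by
  ext i j
  simp [inclMat, Matrix.one_apply, Fin.ext_iff]

lemma mul_inclMat_apply {α : Type*} {n p : ℕ} (A : Matrix α (Fin p) F) (i : α) (j : Fin n) :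
    (A * inclMat F n p) i j = if h : (j : ℕ) < p then A i ⟨j, h⟩ else 0 := by
  rw [Matrix.mul_apply]
  split_ifs with h
  · rw [Finset.sum_eq_single ⟨j, h⟩]
    · simp [inclMat]
    · intro b _ hb
      have : (b : ℕ) ≠ j := fun h' => hb (Fin.ext h')
      simp [inclMat, this]
    · simp
  · refine Finset.sum_eq_zero fun b _ => ?_
    have : (b : ℕ) ≠ j := by omega
    simp [inclMat, this]

lemma inclMat_transpose (n m : ℕ) : (inclMat F n m)ᵀ = inclMat F m n := by
  ext i j
  simp [inclMat, eq_comm]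

lemma inclMat_mul_apply {α : Type*} {m p : ℕ} (A : Matrix (Fin p) α F) (i : Fin m) (j : α) :
    (inclMat F p m * A) i j = if h : (i : ℕ) < p then A ⟨i, h⟩ j else 0 := by
  have := mul_inclMat_apply Aᵀ j i
  rwa [← inclMat_transpose, ← Matrix.transpose_mul] at this

lemma inclMat_mul_inclMat {n m p : ℕ} (h : min n m ≤ p) :
    inclMat F p m * inclMat F n p = inclMat F n m := by
  ext i j
  rw [inclMat_mul_apply]
  split_ifs with hi
  · simp [inclMat]
  · have : (i : ℕ) ≠ j := by omega
    simp [inclMat, this]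

lemma inclMat_mul_inclMat_mul {α : Type*} {n m p : ℕ} (h : min n m ≤ p) (A : Matrix (Fin n) α F) :
    inclMat F p m * (inclMat F n p * A) = inclMat F n m * A := by
  rw [← Matrix.mul_assoc, inclMat_mul_inclMat h]

lemma padTo_eq {n : ℕ} (m : ℕ) (A : Matrix (Fin n) (Fin n) F) :
    padTo m A = inclMat F n m * A * inclMat F m n := by
  ext i j
  rw [mul_inclMat_apply]
  simp only [inclMat_mul_apply, padTo, Matrix.of_apply]
  by_cases hi : (i : ℕ) < n <;> by_cases hj : (j : ℕ) < n <;> simp [hi, hj]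

lemma tailProj_eq_diagonal (n m : ℕ) :
    tailProj F n m = Matrix.diagonal fun i : Fin m => if (i : ℕ) < n then 0 else 1 := by
  ext i j
  rw [tailProj, Matrix.sub_apply, inclMat_mul_apply, Matrix.diagonal_apply, Matrix.one_apply]
  by_cases hij : i = j
  · subst hij
    by_cases hi : (i : ℕ) < n <;> simp [inclMat, hi]
  · have : (i : ℕ) ≠ j := fun h => hij (Fin.ext h)
    simp [inclMat, hij, this]

lemma rank_tailProj (n m : ℕ) : (tailProj F n m).rank = m - n := by
  classical
  rw [tailProj_eq_diagonal, Matrix.rank_diagonal, Fintype.card_subtype]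
  have : (Finset.univ.filter fun i : Fin m => (if (i : ℕ) < n then (0 : F) else 1) ≠ 0) =
      Finset.univ.filter fun i : Fin m => ¬ (i : ℕ) < n := by
    ext i
    simp
  rw [this, Finset.filter_not, Finset.card_sdiff_of_subset (Finset.filter_subset _ _)]
  simp [Fin.card_filter_val_lt]
  omega

lemma tailProj_mul_inclMat {n m : ℕ} (h : n ≤ m) : tailProj F n m * inclMat F n m = 0 := by
  rw [tailProj, Matrix.sub_mul, Matrix.one_mul, Matrix.mul_assoc,
    inclMat_mul_inclMat (by omega), inclMat_self]
  simp

lemma inclMat_mul_tailProj {n m : ℕ} (h : n ≤ m) : inclMat F m n * tailProj F n m = 0 := by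
  rw [tailProj, Matrix.mul_sub, Matrix.mul_one, ← Matrix.mul_assoc,
    inclMat_mul_inclMat (by omega), inclMat_self]
  simp

lemma tailProj_mul_self {n m : ℕ} (h : n ≤ m) :
    tailProj F n m * tailProj F n m = tailProj F n m := by
  have : tailProj F n m * (1 - inclMat F n m * inclMat F m n) = tailProj F n m := by
    rw [mul_sub, ← Matrix.mul_assoc, tailProj_mul_inclMat h, Matrix.zero_mul, mul_one, sub_zero]
  exact this

lemma inclMat_mul_padTo_sub_mul {n n' M p q : ℕ} (A : Matrix (Fin n) (Fin n) F)
    (B : Matrix (Fin n') (Fin n') F) (hn : n ≤ M) (hn' : n' ≤ M) :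
    inclMat F M p * (padTo M A - padTo M B) * inclMat F q M =
      inclMat F n p * A * inclMat F q n - inclMat F n' p * B * inclMat F q n' := by
  simp only [padTo_eq, Matrix.mul_sub, Matrix.sub_mul, Matrix.mul_assoc]
  rw [inclMat_mul_inclMat (show min q n ≤ M by omega),
    inclMat_mul_inclMat (show min q n' ≤ M by omega), inclMat_mul_inclMat_mul (by omega),
    inclMat_mul_inclMat_mul (by omega)]

lemma rank_inclMat_mul_sub_le {n n' : ℕ} (p q : ℕ) (A : Matrix (Fin n) (Fin n) F)
    (B : Matrix (Fin n') (Fin n') F) :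
    (inclMat F n p * A * inclMat F q n - inclMat F n' p * B * inclMat F q n').rank ≤
      padRankDiff A B := by
  rw [← inclMat_mul_padTo_sub_mul A B (le_max_left n n') (le_max_right n n')]
  exact Matrix.rank_mul_mul_le _ _ _

lemma rank_intertwiner_le {n n' : ℕ} (A : Matrix (Fin n) (Fin n) F)
    (B : Matrix (Fin n') (Fin n') F) :
    (inclMat F n n' * A - B * inclMat F n n').rank ≤ padRankDiff A B := by
  simpa [inclMat_self] using rank_inclMat_mul_sub_le n' n A B

lemma padRankDiff_le {n n' : ℕ} (A : Matrix (Fin n) (Fin n) F) (B : Matrix (Fin n') (Fin n') F) :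
    padRankDiff A B ≤
      (inclMat F n n' * A - B * inclMat F n n').rank + ((n - n') + (n' - n)) := by
  unfold padRankDiff
  set M := max n n' with hM
  set D := padTo M A - padTo M B with hD
  have h := inclMat_mul_padTo_sub_mul (p := n') (q := n) A B (le_max_left n n') (le_max_right n n')
  rw [inclMat_self, inclMat_self, Matrix.mul_one, Matrix.one_mul, ← hM, ← hD] at h
  have hdec : D = inclMat F n' M * (inclMat F n n' * A - B * inclMat F n n') * inclMat F M n +
      tailProj F n' M * (D * (inclMat F n M * inclMat F M n)) + D * tailProj F n M := by
    have h' : inclMat F n' M * (inclMat F M n' * D * inclMat F n M) * inclMat F M n =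
        (inclMat F n' M * inclMat F M n') * (D * (inclMat F n M * inclMat F M n)) := by
      simp only [Matrix.mul_assoc]
    rw [← h, h', tailProj, tailProj]
    noncomm_ring
  have h1 := Matrix.rank_add_le_add_rank
    (inclMat F n' M * (inclMat F n n' * A - B * inclMat F n n') * inclMat F M n +
      tailProj F n' M * (D * (inclMat F n M * inclMat F M n))) (D * tailProj F n M)
  have h2 := Matrix.rank_add_le_add_rank
    (inclMat F n' M * (inclMat F n n' * A - B * inclMat F n n') * inclMat F M n)
    (tailProj F n' M * (D * (inclMat F n M * inclMat F M n)))
  rw [← hdec] at h1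
  have h3 := Matrix.rank_mul_mul_le (inclMat F n' M)
    (inclMat F n n' * A - B * inclMat F n n') (inclMat F M n)
  have h4 := (Matrix.rank_mul_le_left (tailProj F n' M) (D * (inclMat F n M * inclMat F M n))).trans
    (rank_tailProj _ _).le
  have h5 := (Matrix.rank_mul_le_right D (tailProj F n M)).trans (rank_tailProj _ _).le
  omega

end Truncation

section Evaluation

variable {F : Type} [Field F] {σ τ ι : Type}

lemma evalPoly_zero_tuple {n : ℕ} (P : FreeAlgebra F σ) :
    evalPoly P (0 : σ → Matrix (Fin n) (Fin n) F) =
      algebraMap F _ (FreeAlgebra.algebraMapInv P) := by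
  have : FreeAlgebra.lift F (0 : σ → Matrix (Fin n) (Fin n) F) =
      (Algebra.ofId F _).comp FreeAlgebra.algebraMapInv := by
    ext x : 2
    simp [FreeAlgebra.algebraMapInv]
  exact DFunLike.congr_fun this P

lemma evalPoly_comp {n : ℕ} (φ : FreeAlgebra F σ →ₐ[F] FreeAlgebra F τ) (P : FreeAlgebra F σ)
    (A : τ → Matrix (Fin n) (Fin n) F) :
    evalPoly P (fun j => evalPoly (φ (FreeAlgebra.ι F j)) A) = evalPoly (φ P) A := by
  have : FreeAlgebra.lift F (fun j => evalPoly (φ (FreeAlgebra.ι F j)) A) =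
      (FreeAlgebra.lift F A).comp φ := by
    ext x : 2
    simp [evalPoly]
  exact DFunLike.congr_fun this P

/-- Evaluation is Lipschitz for approximate intertwining in rank. -/
lemma exists_rank_intertwiner_evalPoly_le (P : FreeAlgebra F σ) :
    ∃ C : ℕ, ∀ (n m : ℕ) (T : Matrix (Fin m) (Fin n) F) (A : σ → Matrix (Fin n) (Fin n) F)
      (B : σ → Matrix (Fin m) (Fin m) F) (κ : ℝ), 0 ≤ κ →
      (∀ j, ((T * A j - B j * T).rank : ℝ) ≤ κ) →
      ((T * evalPoly P A - evalPoly P B * T).rank : ℝ) ≤ C * κ := by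
  unfold evalPoly
  induction P using FreeAlgebra.induction with
  | grade0 c =>
    refine ⟨0, fun n m T A B κ hκ h => ?_⟩
    simp [Algebra.algebraMap_eq_smul_one]
  | grade1 x => exact ⟨1, fun n m T A B κ hκ h => by simpa using h x⟩
  | mul X Y hX hY =>
    obtain ⟨C, hC⟩ := hX
    obtain ⟨D, hD⟩ := hY
    refine ⟨C + D, fun n m T A B κ hκ h => ?_⟩
    have h1 := hC n m T A B κ hκ h
    have h2 := hD n m T A B κ hκ h
    simp only [map_mul]
    set X₁ := FreeAlgebra.lift F A X
    set Y₁ := FreeAlgebra.lift F A Y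
    set X₂ := FreeAlgebra.lift F B X
    set Y₂ := FreeAlgebra.lift F B Y
    have e : T * (X₁ * Y₁) - X₂ * Y₂ * T =
        (T * X₁ - X₂ * T) * Y₁ + X₂ * (T * Y₁ - Y₂ * T) := by
      simp only [Matrix.mul_sub, Matrix.sub_mul, Matrix.mul_assoc]
      abel
    have h3 : (T * (X₁ * Y₁) - X₂ * Y₂ * T).rank ≤
        (T * X₁ - X₂ * T).rank + (T * Y₁ - Y₂ * T).rank := by
      rw [e]
      exact (Matrix.rank_add_le_add_rank _ _).trans
        (add_le_add (Matrix.rank_mul_le_left _ _) (Matrix.rank_mul_le_right _ _))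
    have h4 : ((T * (X₁ * Y₁) - X₂ * Y₂ * T).rank : ℝ) ≤
        (T * X₁ - X₂ * T).rank + (T * Y₁ - Y₂ * T).rank := by exact_mod_cast h3
    push_cast
    linarith
  | add X Y hX hY =>
    obtain ⟨C, hC⟩ := hX
    obtain ⟨D, hD⟩ := hY
    refine ⟨C + D, fun n m T A B κ hκ h => ?_⟩
    have h1 := hC n m T A B κ hκ h
    have h2 := hD n m T A B κ hκ h
    simp only [map_add]
    set X₁ := FreeAlgebra.lift F A X
    set Y₁ := FreeAlgebra.lift F A Y
    set X₂ := FreeAlgebra.lift F B X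
    set Y₂ := FreeAlgebra.lift F B Y
    have e : T * (X₁ + Y₁) - (X₂ + Y₂) * T = (T * X₁ - X₂ * T) + (T * Y₁ - Y₂ * T) := by
      simp only [Matrix.mul_add, Matrix.add_mul]
      abel
    have h3 : ((T * (X₁ + Y₁) - (X₂ + Y₂) * T).rank : ℝ) ≤
        (T * X₁ - X₂ * T).rank + (T * Y₁ - Y₂ * T).rank := by
      rw [e]
      exact_mod_cast Matrix.rank_add_le_add_rank _ _
    push_cast
    linarith

lemma evalPoly_intertwine (P : FreeAlgebra F σ) {n m : ℕ} {T : Matrix (Fin m) (Fin n) F}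
    {A : σ → Matrix (Fin n) (Fin n) F} {B : σ → Matrix (Fin m) (Fin m) F}
    (h : ∀ j, T * A j = B j * T) : T * evalPoly P A = evalPoly P B * T := by
  obtain ⟨C, hC⟩ := exists_rank_intertwiner_evalPoly_le P
  have := hC n m T A B 0 le_rfl (fun j => by simp [h j])
  rw [mul_zero] at this
  exact sub_eq_zero.mp (Matrix.eq_zero_of_rank_eq_zero (by exact_mod_cast this.antisymm (by simp)))

/-- Elements of the ideal generated by the relations have small rank wherever the relations do. -/
lemma exists_rank_evalPoly_le_of_mem_span {Q : ι → FreeAlgebra F σ} {x : FreeAlgebra F σ}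
    (hx : x ∈ TwoSidedIdeal.span (Set.range Q)) :
    ∃ C : ℕ, ∀ (n : ℕ) (A : σ → Matrix (Fin n) (Fin n) F) (κ : ℝ), 0 ≤ κ →
      (∀ i, ((evalPoly (Q i) A).rank : ℝ) ≤ κ) → ((evalPoly x A).rank : ℝ) ≤ C * κ := by
  unfold evalPoly
  induction hx using TwoSidedIdeal.span_induction with
  | mem x h =>
    obtain ⟨i, rfl⟩ := h
    exact ⟨1, fun n A κ hκ h => by simpa using h i⟩
  | zero => exact ⟨0, fun n A κ hκ h => by simp⟩
  | add x y _ _ hx hy =>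
    obtain ⟨C, hC⟩ := hx
    obtain ⟨D, hD⟩ := hy
    refine ⟨C + D, fun n A κ hκ h => ?_⟩
    have h1 := hC n A κ hκ h
    have h2 := hD n A κ hκ h
    have h3 : ((FreeAlgebra.lift F A (x + y)).rank : ℝ) ≤
        (FreeAlgebra.lift F A x).rank + (FreeAlgebra.lift F A y).rank := by
      rw [map_add]
      exact_mod_cast Matrix.rank_add_le_add_rank _ _
    push_cast
    linarith
  | neg x _ hx =>
    obtain ⟨C, hC⟩ := hx
    refine ⟨C, fun n A κ hκ h => ?_⟩
    rw [map_neg, Matrix.rank_neg_eq]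
    exact hC n A κ hκ h
  | left_absorb a x _ hx =>
    obtain ⟨C, hC⟩ := hx
    refine ⟨C, fun n A κ hκ h => le_trans ?_ (hC n A κ hκ h)⟩
    rw [map_mul]
    exact_mod_cast Matrix.rank_mul_le_right _ _
  | right_absorb b x _ hx =>
    obtain ⟨C, hC⟩ := hx
    refine ⟨C, fun n A κ hκ h => le_trans ?_ (hC n A κ hκ h)⟩
    rw [map_mul]
    exact_mod_cast Matrix.rank_mul_le_left _ _

lemma evalPoly_eq_zero_of_mem_span {Q : ι → FreeAlgebra F σ} {x : FreeAlgebra F σ}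
    (hx : x ∈ TwoSidedIdeal.span (Set.range Q)) {n : ℕ} {A : σ → Matrix (Fin n) (Fin n) F}
    (h : ∀ i, evalPoly (Q i) A = 0) : evalPoly x A = 0 := by
  obtain ⟨C, hC⟩ := exists_rank_evalPoly_le_of_mem_span hx
  have := hC n A 0 le_rfl (fun i => by simp [h i])
  rw [mul_zero] at this
  exact Matrix.eq_zero_of_rank_eq_zero (by exact_mod_cast this.antisymm (by simp))

end Evaluation

section SizeControl

variable {F : Type} [Field F] {σ ι : Type}

lemma exists_inclusion_of_complement {n m k : ℕ} (hm : m = n + k) :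
    ∃ (K : Matrix (Fin m) (Fin k) F) (L : Matrix (Fin k) (Fin m) F),
      K * L = tailProj F n m ∧ L * K = 1 ∧ L * inclMat F n m = 0 ∧ inclMat F m n * K = 0 := by
  have hnm : n ≤ m := by omega
  obtain ⟨K, L, L', s, hKL, hL', hs⟩ :=
    (tailProj F n m).exists_rank_factorization (k := k) (by rw [rank_tailProj]; omega)
  have hL : L = L' * tailProj F n m := by
    rw [← hKL, ← Matrix.mul_assoc, hL', Matrix.one_mul]
  have hK : K = tailProj F n m * s := by
    rw [← hKL, Matrix.mul_assoc, hs, Matrix.mul_one]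
  have hidem : tailProj F n m * tailProj F n m = tailProj F n m := tailProj_mul_self hnm
  refine ⟨K, L, hKL, ?_, ?_, ?_⟩
  · rw [hL, hK, Matrix.mul_assoc, ← Matrix.mul_assoc (tailProj F n m), hidem, ← hKL,
      Matrix.mul_assoc, hs, Matrix.mul_one, hL']
  · rw [hL, Matrix.mul_assoc, tailProj_mul_inclMat hnm, Matrix.mul_zero]
  · rw [hK, ← Matrix.mul_assoc, inclMat_mul_tailProj hnm, Matrix.zero_mul]

/-- If a relation has a nonzero constant term, an approximate solution cannot be close to a tuple
of much smaller matrices. -/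
lemma exists_size_sub_le {P : FreeAlgebra F σ} (hP : FreeAlgebra.algebraMapInv P ≠ 0) :
    ∃ C : ℕ, ∀ (n n' : ℕ) (A : σ → Matrix (Fin n) (Fin n) F)
      (B : σ → Matrix (Fin n') (Fin n') F) (κ : ℝ), n' ≤ n → 0 ≤ κ →
      (∀ j, (padRankDiff (A j) (B j) : ℝ) ≤ κ) →
      (n : ℝ) - n' ≤ (evalPoly P A).rank + C * κ := by
  obtain ⟨C, hC⟩ := exists_rank_intertwiner_evalPoly_le P
  refine ⟨C, fun n n' A B κ hn hκ h => ?_⟩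
  set T := tailProj F n' n with hT
  set c := FreeAlgebra.algebraMapInv P with hc
  have h1 := hC n n T 0 A κ hκ fun j => by
    refine le_trans ?_ (h j)
    have h2 := rank_inclMat_mul_sub_le n n (A j) (B j)
    rw [inclMat_self, Matrix.one_mul, Matrix.mul_one] at h2
    have h3 : T * (0 : σ → Matrix (Fin n) (Fin n) F) j - A j * T =
        (A j - inclMat F n' n * B j * inclMat F n n') * (-T) := by
      rw [Matrix.mul_neg, Matrix.sub_mul, Matrix.mul_assoc (inclMat F n' n * B j), hT,
        inclMat_mul_tailProj hn]
      simp
    rw [h3]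
    exact_mod_cast (Matrix.rank_mul_le_left _ _).trans h2
  rw [evalPoly_zero_tuple, ← hc] at h1
  have h4 : T = (T * algebraMap F _ c - evalPoly P A * T) * algebraMap F _ c⁻¹ +
      evalPoly P A * (T * algebraMap F _ c⁻¹) := by
    rw [sub_mul, mul_assoc, ← map_mul, mul_inv_cancel₀ hP, map_one, mul_one, mul_assoc]
    abel
  have h5 : T.rank ≤ (T * algebraMap F _ c - evalPoly P A * T).rank + (evalPoly P A).rank := by
    conv_lhs => rw [h4]
    exact (Matrix.rank_add_le_add_rank _ _).trans
      (add_le_add (Matrix.rank_mul_le_left _ _) (Matrix.rank_mul_le_left _ _))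
  rw [hT, rank_tailProj, ← hT] at h5
  have h6 : ((n - n' : ℕ) : ℝ) ≤
      (T * algebraMap F _ c - evalPoly P A * T).rank + (evalPoly P A).rank := by
    exact_mod_cast h5
  rw [Nat.cast_sub hn] at h6
  linarith

/-- Zero-padding a solution gives a solution when the relation has no constant term. -/
lemma evalPoly_pad_eq_zero {P : FreeAlgebra F σ} (hP : FreeAlgebra.algebraMapInv P = 0) {n n' : ℕ}
    (hn : n' ≤ n) {B : σ → Matrix (Fin n') (Fin n') F} (hB : evalPoly P B = 0) :
    evalPoly P (fun j => inclMat F n' n * B j * inclMat F n n') = 0 := by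
  set B' : σ → Matrix (Fin n) (Fin n) F := fun j => inclMat F n' n * B j * inclMat F n n'
  have h1 : evalPoly P B' * inclMat F n' n = 0 := by
    rw [← evalPoly_intertwine P (T := inclMat F n' n) (A := B), hB, Matrix.mul_zero]
    intro j
    simp only [B', Matrix.mul_assoc]
    rw [inclMat_mul_inclMat (by omega), inclMat_self, Matrix.mul_one]
  have h2 : evalPoly P B' * tailProj F n' n = 0 := by
    rw [← evalPoly_intertwine P (T := tailProj F n' n) (A := 0), evalPoly_zero_tuple, hP]
    · simp
    intro j
    simp only [B', Matrix.mul_assoc]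
    rw [inclMat_mul_tailProj hn]
    simp
  have h3 : evalPoly P B' =
      evalPoly P B' * inclMat F n' n * inclMat F n n' + evalPoly P B' * tailProj F n' n := by
    rw [tailProj, mul_sub, mul_one, Matrix.mul_assoc]
    abel
  rw [h3, h1, h2, Matrix.zero_mul, add_zero]

/-- A solution of large size close to a tuple of smaller matrices can be replaced by a quotient of
controlled size. -/
lemma exists_quotient_solution [Fintype σ] {n n' : ℕ} (hn : n ≤ n')
    (A : σ → Matrix (Fin n) (Fin n) F) (B : σ → Matrix (Fin n') (Fin n') F) :
    ∃ m : ℕ, n ≤ m ∧ m ≤ n + ∑ j, padRankDiff (A j) (B j) ∧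
      ∃ B' : σ → Matrix (Fin m) (Fin m) F,
        (∀ P : FreeAlgebra F σ, evalPoly P B = 0 → evalPoly P B' = 0) ∧
        ∀ j, (inclMat F n m * A j - B' j * inclMat F n m).rank ≤ padRankDiff (A j) (B j) := by
  classical
  set T := tailProj F n n' with hT
  have hTJ : T * inclMat F n n' = 0 := tailProj_mul_inclMat hn
  have hJT : inclMat F n' n * T = 0 := inclMat_mul_tailProj hn
  have hTT : T * T = T := tailProj_mul_self hn
  let N : Matrix (σ × Fin n') (Fin n') F := Matrix.of fun x i => (B x.1 * T) x.2 i
  let r : σ → Matrix (Fin n') (σ × Fin n') F := fun j =>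
    Matrix.of fun a x => if (j, a) = x then 1 else 0
  have hrN : ∀ j, r j * N = B j * T := by
    intro j
    ext a i
    simp [r, N, Matrix.mul_apply]
  have hN : N = ∑ j, (r j)ᵀ * (B j * T) := by
    ext ⟨j, a⟩ i
    rw [Matrix.sum_apply, Finset.sum_eq_single j]
    · rw [Matrix.mul_apply, Finset.sum_eq_single a]
      · simp [r, N]
      · intro b _ hb
        simp [r, hb]
      · simp
    · intro b _ hb
      simp [r, hb, Matrix.mul_apply]
    · simp
  have hBT : ∀ j, (B j * T).rank ≤ padRankDiff (A j) (B j) := by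
    intro j
    have h2 := rank_inclMat_mul_sub_le n' n' (A j) (B j)
    rw [inclMat_self, Matrix.one_mul, Matrix.mul_one] at h2
    have h3 : B j * T = (inclMat F n n' * A j * inclMat F n' n - B j) * (-T) := by
      rw [Matrix.mul_neg, Matrix.sub_mul, Matrix.mul_assoc (inclMat F n n' * A j), hJT]
      simp
    rw [h3]
    exact (Matrix.rank_mul_le_left _ _).trans h2
  have hrank : N.rank ≤ ∑ j, padRankDiff (A j) (B j) := by
    rw [hN]
    exact (Matrix.rank_sum_le_sum_rank _ _).trans
      (Finset.sum_le_sum fun j _ => (Matrix.rank_mul_le_right _ _).trans (hBT j))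
  have hNT : N * T = N := by
    rw [hN, Matrix.sum_mul]
    simp only [Matrix.mul_assoc, hTT]
  obtain ⟨k, hk⟩ : ∃ k, N.rank = k := ⟨_, rfl⟩
  obtain ⟨R, q, L', s₀, hRq, hL', hs₀⟩ := N.exists_rank_factorization hk
  have hq : q = L' * N := by rw [← hRq, ← Matrix.mul_assoc, hL', Matrix.one_mul]
  have hqT : q * T = q := by rw [hq, Matrix.mul_assoc, hNT]
  have hqJ : q * inclMat F n n' = 0 := by rw [← hqT, Matrix.mul_assoc, hTJ, Matrix.mul_zero]
  obtain ⟨s, hqs, hJs, hTs⟩ : ∃ s : Matrix (Fin n') (Fin k) F,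
      q * s = 1 ∧ inclMat F n' n * s = 0 ∧ T * s = s :=
    ⟨T * s₀, by rw [← Matrix.mul_assoc, hqT, hs₀],
      by rw [← Matrix.mul_assoc, hJT, Matrix.zero_mul], by rw [← Matrix.mul_assoc, hTT]⟩
  obtain ⟨m, hm⟩ : ∃ m, m = n + k := ⟨_, rfl⟩
  obtain ⟨K, L, hKL, hLK, hLJ, hJK⟩ := exists_inclusion_of_complement (F := F) hm
  set p : Matrix (Fin m) (Fin n') F := inclMat F n m * inclMat F n' n + K * q with hp
  set t : Matrix (Fin n') (Fin m) F := inclMat F n n' * inclMat F m n + s * L with ht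
  have hJJ : inclMat F n' n * inclMat F n n' = 1 := by
    rw [inclMat_mul_inclMat (by omega), inclMat_self]
  have hJJm : inclMat F m n * inclMat F n m = 1 := by
    rw [inclMat_mul_inclMat (by omega), inclMat_self]
  have hpJ : p * inclMat F n n' = inclMat F n m := by
    rw [hp, Matrix.add_mul, Matrix.mul_assoc, Matrix.mul_assoc, hqJ, hJJ]
    simp
  have hps : p * s = K := by
    rw [hp, Matrix.add_mul, Matrix.mul_assoc, Matrix.mul_assoc, hqs, hJs]
    simp
  have hpt : p * t = 1 := by
    rw [ht, Matrix.mul_add, ← Matrix.mul_assoc, ← Matrix.mul_assoc, hpJ, hps, hKL, tailProj]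
    abel
  have hqp : q = L * p := by
    rw [hp, Matrix.mul_add, ← Matrix.mul_assoc, ← Matrix.mul_assoc, hLJ, hLK]
    simp
  have htp : t * p = inclMat F n n' * inclMat F n' n + s * q := by
    have h1 : inclMat F m n * p = inclMat F n' n := by
      rw [hp, Matrix.mul_add, ← Matrix.mul_assoc, ← Matrix.mul_assoc, hJK, hJJm]
      simp
    rw [ht, Matrix.add_mul, Matrix.mul_assoc, Matrix.mul_assoc, h1, ← hqp]
  have hBsq : ∀ j, B j * (s * q) = B j * T := by
    intro j
    have h1 : B j * T = r j * R * q := by rw [Matrix.mul_assoc, hRq, hrN]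
    rw [← hTs, Matrix.mul_assoc, ← Matrix.mul_assoc (B j), h1, Matrix.mul_assoc (r j * R),
      ← Matrix.mul_assoc q, hqs, Matrix.one_mul]
  have hBtp : ∀ j, B j * (t * p) = B j := by
    intro j
    rw [htp, Matrix.mul_add, hBsq, hT, tailProj, Matrix.mul_sub, Matrix.mul_one]
    abel
  have hint : ∀ j, p * B j = p * B j * t * p := by
    intro j
    rw [Matrix.mul_assoc (p * B j), Matrix.mul_assoc p, hBtp]
  refine ⟨m, by omega, by omega, fun j => p * B j * t, fun P hP => ?_, fun j => ?_⟩
  · have h1 := evalPoly_intertwine P (T := p) (A := B) (B := fun j => p * B j * t) hint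
    rw [hP, Matrix.mul_zero] at h1
    rw [← Matrix.mul_one (evalPoly P _), ← hpt, ← Matrix.mul_assoc, ← h1, Matrix.zero_mul]
  · have h1 : inclMat F n m * A j - p * B j * t * inclMat F n m =
        p * (inclMat F n n' * A j - B j * inclMat F n n') := by
      conv_lhs => rw [← hpJ, ← Matrix.mul_assoc (p * B j * t), ← hint]
      simp only [Matrix.mul_sub, Matrix.mul_assoc]
    rw [h1]
    exact (Matrix.rank_mul_le_right _ _).trans (rank_intertwiner_le _ _)

/-- In a rank-stable presentation the exact solutions can be chosen of size close to that of the
approximate ones. -/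
lemma RankStable.exists_solution_of_close_size [Fintype σ] {P : ι → FreeAlgebra F σ}
    (hP : RankStable F P) {ε : ℝ} (hε : 0 < ε) :
    ∃ δ : ℝ, 0 < δ ∧ ∀ n : ℕ, 0 < n → ∀ A : σ → Matrix (Fin n) (Fin n) F,
      (∀ i, ((evalPoly (P i) A).rank : ℝ) < δ * n) →
      ∃ n' : ℕ, 0 < n' ∧ |(n : ℝ) - n'| ≤ ε * n ∧ ∃ B : σ → Matrix (Fin n') (Fin n') F,
        (∀ i, evalPoly (P i) B = 0) ∧
        ∀ j, ((inclMat F n n' * A j - B j * inclMat F n n').rank : ℝ) ≤ ε * n := by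
  classical
  obtain ⟨C, hC⟩ : ∃ C : ℕ, ∀ (n n' : ℕ) (A : σ → Matrix (Fin n) (Fin n) F)
      (B : σ → Matrix (Fin n') (Fin n') F) (κ μ : ℝ), n' ≤ n → 0 ≤ κ →
      (∀ j, (padRankDiff (A j) (B j) : ℝ) ≤ κ) →
      (∀ i, ((evalPoly (P i) A).rank : ℝ) ≤ μ) →
      (∀ i, FreeAlgebra.algebraMapInv (P i) = 0) ∨ (n : ℝ) - n' ≤ μ + C * κ := by
    by_cases h : ∀ i, FreeAlgebra.algebraMapInv (P i) = 0
    · exact ⟨0, fun _ _ _ _ _ _ _ _ _ _ => Or.inl h⟩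
    · push Not at h
      obtain ⟨i, hi⟩ := h
      obtain ⟨C, hC⟩ := exists_size_sub_le hi
      refine ⟨C, fun n n' A B κ μ hn hκ h1 h2 => Or.inr ?_⟩
      have := hC n n' A B κ hn hκ h1
      have := h2 i
      linarith
  set c : ℝ := 2 * (C + Fintype.card σ + 1) with hc
  have hc0 : 0 < c := by positivity
  obtain ⟨δ, hδ, hδ'⟩ := hP (ε / c) (by positivity)
  refine ⟨min δ (ε / 2), by positivity, fun n hn A hA => ?_⟩
  have hn0 : (0 : ℝ) < n := by exact_mod_cast hn
  obtain ⟨n', hn', B, hB, hAB⟩ := hδ' n hn A fun i =>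
    (hA i).trans_le (by gcongr; exact min_le_left _ _)
  obtain ⟨κ, hκdef⟩ : ∃ κ : ℝ, κ = ε / c * n := ⟨_, rfl⟩
  have hκ : ∀ j, (padRankDiff (A j) (B j) : ℝ) ≤ κ := fun j => hκdef ▸ (hAB j).le
  have hκ0 : 0 ≤ κ := by rw [hκdef]; positivity
  have hcκ : 2 * (C * κ) + 2 * (Fintype.card σ * κ) + 2 * κ = ε * n := by
    have : c * κ = ε * n := by rw [hκdef]; field_simp
    rw [← this, hc]
    ring
  have hcard : (0 : ℝ) ≤ Fintype.card σ * κ := by positivity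
  have hCκ : (0 : ℝ) ≤ C * κ := by positivity
  have hle : κ ≤ ε * n := by linarith
  have hμ : ∀ i, ((evalPoly (P i) A).rank : ℝ) ≤ ε * n / 2 := fun i => by
    refine (hA i).le.trans ?_
    rw [mul_div_right_comm]
    gcongr
    exact min_le_right _ _
  clear_value c
  rcases le_total n' n with hnn | hnn
  · rcases hC n n' A B _ _ hnn hκ0 hκ hμ with h0 | h0
    · refine ⟨n, hn, by rw [sub_self, abs_zero]; positivity,
        fun j => inclMat F n' n * B j * inclMat F n n',
        fun i => evalPoly_pad_eq_zero (h0 i) hnn (hB i), fun j => le_trans ?_ ((hκ j).trans hle)⟩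
      have := rank_inclMat_mul_sub_le n n (A j) (B j)
      rw [inclMat_self, Matrix.mul_one] at this
      rw [inclMat_self, Matrix.mul_one]
      exact_mod_cast this
    · refine ⟨n', hn', ?_, B, hB, fun j => le_trans ?_ ((hκ j).trans hle)⟩
      · have : (n' : ℝ) ≤ n := by exact_mod_cast hnn
        rw [abs_of_nonneg (by linarith)]
        linarith
      · exact_mod_cast rank_intertwiner_le (A j) (B j)
  · obtain ⟨m, hnm, hmn, B', hB', hAB'⟩ := exists_quotient_solution hnn A B
    refine ⟨m, by omega, ?_, B', fun i => hB' _ (hB i), fun j =>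
      le_trans (by exact_mod_cast hAB' j) ((hκ j).trans hle)⟩
    have h1 : (m : ℝ) ≤ n + ∑ j, (padRankDiff (A j) (B j) : ℝ) := by exact_mod_cast hmn
    have h2 : ∑ j, (padRankDiff (A j) (B j) : ℝ) ≤ Fintype.card σ * κ := by
      simpa using Finset.sum_le_sum fun j (_ : j ∈ Finset.univ) => hκ j
    have h3 : (n : ℝ) ≤ m := by exact_mod_cast hnm
    rw [abs_sub_comm, abs_of_nonneg (by linarith)]
    linarith

end SizeControl

/-- **Independence of presentation.** If two finite presentations present isomorphic
`F`-algebras (i.e. there is an `F`-algebra `C` together with surjections from the two free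
algebras whose kernels are the two-sided ideals generated by the respective relations),
and the first presentation is rank-stable, then so is the second. -/
theorem stmt0_rank_stability_independent_of_presentation
    (F : Type) [Field F] (d e r s : ℕ)
    (P : Fin r → FreeAlgebra F (Fin d)) (Q : Fin s → FreeAlgebra F (Fin e))
    (C : Type) [Ring C] [Algebra F C]
    (π₁ : FreeAlgebra F (Fin d) →ₐ[F] C) (π₂ : FreeAlgebra F (Fin e) →ₐ[F] C)
    (hπ₁ : Function.Surjective π₁) (hπ₂ : Function.Surjective π₂)
    (hker₁ : ∀ x, π₁ x = 0 ↔ x ∈ TwoSidedIdeal.span (Set.range P))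
    (hker₂ : ∀ y, π₂ y = 0 ↔ y ∈ TwoSidedIdeal.span (Set.range Q))
    (hP : RankStable F P) :
    RankStable F Q := by
  choose f hf using fun j : Fin d => hπ₂ (π₁ (FreeAlgebra.ι F j))
  choose g hg using fun k : Fin e => hπ₁ (π₂ (FreeAlgebra.ι F k))
  set φ := FreeAlgebra.lift F f with hφdef
  set ψ := FreeAlgebra.lift F g with hψdef
  have hφ : ∀ x, π₂ (φ x) = π₁ x := by
    have : π₂.comp φ = π₁ := by
      ext j
      simp [φ, hf]
    exact DFunLike.congr_fun this
  have hψ : ∀ y, π₁ (ψ y) = π₂ y := by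
    have : π₁.comp ψ = π₂ := by
      ext k
      simp [ψ, hg]
    exact DFunLike.congr_fun this
  have hφP : ∀ i, φ (P i) ∈ TwoSidedIdeal.span (Set.range Q) := fun i => by
    rw [← hker₂, hφ, hker₁]
    exact TwoSidedIdeal.subset_span ⟨i, rfl⟩
  have hψQ : ∀ i, ψ (Q i) ∈ TwoSidedIdeal.span (Set.range P) := fun i => by
    rw [← hker₁, hψ, hker₂]
    exact TwoSidedIdeal.subset_span ⟨i, rfl⟩
  have hφψ : ∀ k, FreeAlgebra.ι F k - φ (ψ (FreeAlgebra.ι F k)) ∈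
      TwoSidedIdeal.span (Set.range Q) := fun k => by
    rw [← hker₂, map_sub, hφ, hψ, sub_self]
  choose C₁ hC₁ using fun k : Fin e => exists_rank_intertwiner_evalPoly_le (ψ (FreeAlgebra.ι F k))
  choose C₂ hC₂ using fun k : Fin e => exists_rank_evalPoly_le_of_mem_span (hφψ k)
  choose C₃ hC₃ using fun i : Fin r => exists_rank_evalPoly_le_of_mem_span (hφP i)
  obtain ⟨D₁, hD₁⟩ := Finite.exists_le C₁
  obtain ⟨D₂, hD₂⟩ := Finite.exists_le C₂
  obtain ⟨D₃, hD₃⟩ := Finite.exists_le C₃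
  intro ε hε
  obtain ⟨δ₁, hδ₁, hstab⟩ := hP.exists_solution_of_close_size
    (ε := ε / (4 * (D₁ + 1))) (by positivity)
  refine ⟨min (δ₁ / (D₃ + 1)) (ε / (4 * (D₂ + 1))), by positivity, fun n hn A hA => ?_⟩
  obtain ⟨κ, hκ⟩ : ∃ κ, κ = min (δ₁ / (D₃ + 1)) (ε / (4 * (D₂ + 1))) * (n : ℝ) := ⟨_, rfl⟩
  have hn0 : (0 : ℝ) < n := by exact_mod_cast hn
  have hκ0 : 0 < κ := by rw [hκ]; positivity
  have hQA : ∀ i, ((evalPoly (Q i) A).rank : ℝ) ≤ κ := fun i => hκ ▸ (hA i).le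
  have hκ₃ : D₃ * κ + κ ≤ δ₁ * n := by
    have : κ ≤ δ₁ / (D₃ + 1) * n := by rw [hκ]; gcongr; exact min_le_left _ _
    calc D₃ * κ + κ = (D₃ + 1) * κ := by ring
      _ ≤ (D₃ + 1) * (δ₁ / (D₃ + 1) * n) := by gcongr
      _ = δ₁ * n := by field_simp
  have hκ₂ : D₂ * κ + κ ≤ ε * n / 4 := by
    have : κ ≤ ε / (4 * (D₂ + 1)) * n := by rw [hκ]; gcongr; exact min_le_right _ _
    calc D₂ * κ + κ = (D₂ + 1) * κ := by ring
      _ ≤ (D₂ + 1) * (ε / (4 * (D₂ + 1)) * n) := by gcongr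
      _ = ε * n / 4 := by field_simp
  clear hκ
  obtain ⟨n', hn', hsize, B, hB, hAB⟩ :=
    hstab n hn (fun j => evalPoly (φ (FreeAlgebra.ι F j)) A) fun i => by
      rw [evalPoly_comp]
      have h1 := hC₃ i n A κ hκ0.le hQA
      have h2 : (C₃ i : ℝ) * κ ≤ D₃ * κ := by gcongr; exact_mod_cast hD₃ i
      linarith
  obtain ⟨η, hη⟩ : ∃ η, η = ε / (4 * (D₁ + 1)) * (n : ℝ) := ⟨_, rfl⟩
  have hη0 : 0 < η := by rw [hη]; positivity
  have hη₁ : D₁ * η + η = ε * n / 4 := by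
    rw [hη]
    field_simp
  rw [← hη] at hsize
  simp only [← hη] at hAB
  refine ⟨n', hn', fun k => evalPoly (ψ (FreeAlgebra.ι F k)) B, fun i => ?_, fun k => ?_⟩
  · rw [evalPoly_comp]
    exact evalPoly_eq_zero_of_mem_span (hψQ i) hB
  · have h1 := hC₁ k n n' (inclMat F n n') _ B η hη0.le hAB
    rw [evalPoly_comp] at h1
    have h2 := hC₂ k n A κ hκ0.le hQA
    set X := evalPoly (φ (ψ (FreeAlgebra.ι F k))) A
    set Y := evalPoly (ψ (FreeAlgebra.ι F k)) B
    have h3 : evalPoly (FreeAlgebra.ι F k - φ (ψ (FreeAlgebra.ι F k))) A = A k - X := by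
      simp [evalPoly, X]
    rw [h3] at h2
    have h4 : (inclMat F n n' * A k - Y * inclMat F n n').rank ≤
        (A k - X).rank + (inclMat F n n' * X - Y * inclMat F n n').rank := by
      have : inclMat F n n' * A k - Y * inclMat F n n' =
          inclMat F n n' * (A k - X) + (inclMat F n n' * X - Y * inclMat F n n') := by
        rw [Matrix.mul_sub]
        abel
      rw [this]
      exact (Matrix.rank_add_le_add_rank _ _).trans
        (Nat.add_le_add_right (Matrix.rank_mul_le_right _ _) _)
    have h5 : (padRankDiff (A k) Y : ℝ) ≤
        ((A k - X).rank + (inclMat F n n' * X - Y * inclMat F n n').rank : ℝ) +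
          ((n - n' : ℕ) + (n' - n : ℕ) : ℝ) := by
      exact_mod_cast (padRankDiff_le (A k) Y).trans (Nat.add_le_add_right h4 _)
    have h6 : ((n - n' : ℕ) + (n' - n : ℕ) : ℝ) = |(n : ℝ) - n'| := by
      rcases le_total n n' with h | h
      · rw [Nat.sub_eq_zero_of_le h, Nat.cast_sub h, abs_sub_comm, abs_of_nonneg]
        · simp
        · exact sub_nonneg.mpr (by exact_mod_cast h)
      · rw [Nat.sub_eq_zero_of_le h, Nat.cast_sub h, abs_of_nonneg]
        · simp
        · exact sub_nonneg.mpr (by exact_mod_cast h)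
    have h7 : (C₁ k : ℝ) * η ≤ D₁ * η := by gcongr; exact_mod_cast hD₁ k
    have h8 : (C₂ k : ℝ) * κ ≤ D₂ * κ := by gcongr; exact_mod_cast hD₂ k
    have h9 : 0 < ε * n := by positivity
    linarith
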